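/- Let Φ be an m×m rational matrix not having 1 as an eigenvalue, let T : ℤ^m → GL_n(ℚ) be a group homomorphism such that for every v ∈ ℤ^m the matrix T(v) is semisimple and net, and let M be an n×n complex matrix. Suppose there is a positive integer k such that Φ·(k v) ∈ ℤ^m for all v ∈ ℤ^m and M·T(k v) = T(Φ·(k v))·M for all v ∈ ℤ^m. Then det(I − T(v)·M) = det(I − M) for all v ∈ ℤ^m. -/

import Mathlib

/-- A complex square matrix is *net* if the multiplicative subgroup of `ℂˣ` generated by its
complex eigenvalues contains no root of unity other than `1`. -/
def Matrix.IsNet {n : ℕ} (M : Matrix (Fin n) (Fin n) ℂ) : Prop :=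
  ∀ u ∈ Subgroup.closure {u : ℂˣ | (u : ℂ) ∈ spectrum ℂ M},
    ∀ r : ℕ, 0 < r → u ^ r = 1 → u = 1

/-- A square rational matrix is semisimple if it is diagonalizable over `ℂ`. -/
def IsSemisimpleMat {n : ℕ} (M : Matrix (Fin n) (Fin n) ℚ) : Prop :=
  ∃ P : Matrix (Fin n) (Fin n) ℂ, IsUnit P ∧ ∃ d : Fin n → ℂ,
    M.map (Rat.cast : ℚ → ℂ) = P * Matrix.diagonal d * P⁻¹

namespace Matrix

section

variable {ι R : Type*} [Fintype ι] [DecidableEq ι] [CommRing R]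

theorem det_one_sub_diagonal_mul_of_prod_eq_one (d : ι → R) (N : Matrix ι ι R)
    (h : ∀ (σ : Equiv.Perm ι) (s : Finset ι), {i | σ i ≠ i} ⊆ (s : Set ι) →
      (∀ i ∈ s, N (σ i) i ≠ 0) → ∏ i ∈ s, d i = 1) :
    (1 - diagonal d * N).det = (1 - N).det := by
  have expand (B : Matrix ι ι R) (σ : Equiv.Perm ι) : ∏ i, (1 - B) (σ i) i =
      ∑ t ∈ Finset.univ.powerset, (∏ i ∈ t, (1 : Matrix ι ι R) (σ i) i) *
        ∏ i ∈ Finset.univ \ t, -B (σ i) i := by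
    rw [← Finset.prod_add]
    simp [sub_eq_add_neg]
  rw [det_apply', det_apply']
  refine Finset.sum_congr rfl fun σ _ ↦ ?_
  rw [expand, expand]
  congr 1
  refine Finset.sum_congr rfl fun t _ ↦ ?_
  by_cases hfix : ∀ i ∈ t, σ i = i
  · congr 1
    have hσ : {i | σ i ≠ i} ⊆ ((Finset.univ \ t : Finset ι) : Set ι) := by
      intro i hi
      simpa using fun hit ↦ hi (hfix i hit)
    by_cases hN : ∀ i ∈ Finset.univ \ t, N (σ i) i ≠ 0
    · have hd := h σ _ hσ hN
      rw [← Equiv.Perm.prod_comp σ _ d hσ] at hd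
      simp only [diagonal_mul, ← mul_neg, Finset.prod_mul_distrib, hd, one_mul]
    · push Not at hN
      obtain ⟨i, hi, hi0⟩ := hN
      rw [Finset.prod_eq_zero hi (by simp [hi0]), Finset.prod_eq_zero hi (by simp [hi0])]
  · push Not at hfix
    obtain ⟨i, hi, hne⟩ := hfix
    have h0 : ∏ i ∈ t, (1 : Matrix ι ι R) (σ i) i = 0 :=
      Finset.prod_eq_zero hi (one_apply_ne hne)
    rw [h0, zero_mul, zero_mul]

end

section

variable {ι κ K : Type*} [Fintype ι] [DecidableEq ι] [Field K]

theorem mulVec_eq_smul_of_mem_maxGenEigenspace {P : Matrix ι ι K} (hP : IsUnit P)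
    {d : ι → K} {μ : K} {x : ι → K}
    (hx : x ∈ Module.End.maxGenEigenspace (toLin' (P * diagonal d * P⁻¹)) μ) :
    (P * diagonal d * P⁻¹) *ᵥ x = μ • x := by
  have hPP : P⁻¹ * P = 1 := nonsing_inv_mul _ ((isUnit_iff_isUnit_det P).1 hP)
  have hPP' : P * P⁻¹ = 1 := mul_nonsing_inv _ ((isUnit_iff_isUnit_det P).1 hP)
  have key (k : ℕ) (y : ι → K) (i : ι) :
      (P⁻¹ *ᵥ ((toLin' (P * diagonal d * P⁻¹) - μ • (1 : Module.End K (ι → K))) ^ k) y) i =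
        (d i - μ) ^ k * (P⁻¹ *ᵥ y) i := by
    induction k generalizing y with
    | zero => simp
    | succ k ih =>
      rw [pow_succ, Module.End.mul_apply, ih]
      simp only [LinearMap.sub_apply, toLin'_apply, LinearMap.smul_apply, Module.End.one_apply,
        mulVec_sub, mulVec_smul, mulVec_mulVec]
      rw [← mul_assoc, ← mul_assoc, hPP, one_mul, ← mulVec_mulVec]
      simp only [Pi.sub_apply, mulVec_diagonal, Pi.smul_apply, smul_eq_mul]
      ring
  rw [Module.End.mem_maxGenEigenspace] at hx
  obtain ⟨k, hk⟩ := hx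
  have hz : P⁻¹ *ᵥ ((P * diagonal d * P⁻¹) *ᵥ x - μ • x) = 0 := by
    ext i
    have h1 := key 1 x i
    have h2 := key k x i
    rw [hk, mulVec_zero, Pi.zero_apply] at h2
    simp only [pow_one, LinearMap.sub_apply, toLin'_apply, LinearMap.smul_apply,
      Module.End.one_apply] at h1
    rw [h1, Pi.zero_apply]
    rcases mul_eq_zero.1 h2.symm with h | h
    · rw [eq_zero_of_pow_eq_zero h, zero_mul]
    · rw [h, mul_zero]
  have := congrArg (P *ᵥ ·) hz
  simp only [mulVec_mulVec, hPP', one_mulVec, mulVec_zero] at this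
  exact sub_eq_zero.1 this

theorem exists_simultaneous_diagonalization [IsAlgClosed K] (A : κ → Matrix ι ι K)
    (hcomm : ∀ a b, Commute (A a) (A b))
    (hdiag : ∀ a, ∃ P : Matrix ι ι K, IsUnit P ∧ ∃ d : ι → K, A a = P * diagonal d * P⁻¹) :
    ∃ P : Matrix ι ι K, IsUnit P ∧ ∃ d : κ → ι → K, ∀ a, A a = P * diagonal (d a) * P⁻¹ := by
  let S : Set (ι → K) := {x | ∃ χ : κ → K, ∀ a, A a *ᵥ x = χ a • x}
  have hS : ⊤ ≤ Submodule.span K S := by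
    rw [← Module.End.iSup_iInf_maxGenEigenspace_eq_top_of_iSup_maxGenEigenspace_eq_top_of_commute
      (fun a ↦ toLin' (A a))
      (fun a b _ ↦ by
        change toLin' (A a) * toLin' (A b) = toLin' (A b) * toLin' (A a)
        rw [Module.End.mul_eq_comp, Module.End.mul_eq_comp, ← toLin'_mul, ← toLin'_mul,
          (hcomm a b).eq])
      (fun a ↦ Module.End.iSup_maxGenEigenspace_eq_top _)]
    refine iSup_le fun χ x hx ↦ Submodule.subset_span ⟨χ, fun a ↦ ?_⟩
    obtain ⟨P, hP, d, hA⟩ := hdiag a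
    have hxa := (Submodule.mem_iInf _).1 hx a
    rw [hA] at hxa ⊢
    exact mulVec_eq_smul_of_mem_maxGenEigenspace hP hxa
  let b₀ := Module.Basis.ofSpan hS
  let b := b₀.reindex (b₀.indexEquiv (Pi.basisFun K ι))
  have hb (i : ι) : ∃ χ : κ → K, ∀ a, A a *ᵥ b i = χ a • b i :=
    Module.Basis.ofSpan_subset hS (by simp [b, b₀])
  choose χ hχ using hb
  let P := (Pi.basisFun K ι).toMatrix b
  have hPu : IsUnit P := by
    let := (Pi.basisFun K ι).invertibleToMatrix b
    exact isUnit_of_invertible P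
  refine ⟨P, hPu, fun a i ↦ χ i a, fun a ↦ ?_⟩
  have hAP : A a * P = P * diagonal fun i ↦ χ i a := by
    ext i j
    have := congrFun (hχ j a) i
    rw [mul_diagonal]
    simpa [P, mul_apply, mulVec, dotProduct, Module.Basis.toMatrix_apply, mul_comm] using this
  rw [← hAP, mul_assoc, mul_nonsing_inv _ ((isUnit_iff_isUnit_det P).1 hPu), mul_one]

theorem mem_spectrum_conj_diagonal {P : Matrix ι ι K} (hP : IsUnit P) (d : ι → K) (i : ι) :
    d i ∈ spectrum K (P * diagonal d * P⁻¹) := by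
  rw [← hP.unit_spec, ← coe_units_inv, spectrum.units_conjugate, spectrum_diagonal]
  exact Set.mem_range_self i

end

theorem exists_pos_nsmul_eq_sub {ι : Type*} [Fintype ι] [DecidableEq ι]
    (Φ : Matrix ι ι ℚ) (hΦ : (Φ - 1).det ≠ 0) {k : ℕ} (hk : 0 < k)
    (hint : ∀ v : ι → ℤ, ∃ w : ι → ℤ,
      Φ *ᵥ (fun t ↦ (((k : ℤ) * v t : ℤ) : ℚ)) = fun t ↦ ((w t : ℤ) : ℚ)) :
    ∃ r : ℕ, 0 < r ∧ ∀ v : ι → ℤ, ∃ u w : ι → ℤ,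
      (Φ *ᵥ (fun t ↦ (((k : ℤ) * u t : ℤ) : ℚ)) = fun t ↦ ((w t : ℤ) : ℚ)) ∧
        r • v = w - (k : ℤ) • u := by
  choose W hW using hint
  let C : Matrix ι ι ℤ := of fun i j ↦ W (Pi.single j 1) i
  have hC : C.map (Int.cast : ℤ → ℚ) = (k : ℚ) • Φ := by
    ext i j
    have := congrFun (hW (Pi.single j 1)) i
    simp only [map_apply, of_apply, smul_apply, smul_eq_mul, C]
    rw [← this]
    simp [mulVec, dotProduct, Pi.single_apply, mul_comm]
  let B : Matrix ι ι ℤ := C - (k : ℤ) • (1 : Matrix ι ι ℤ)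
  have hB : (Int.castRingHom ℚ).mapMatrix B = (k : ℚ) • (Φ - 1) := by
    rw [smul_sub, ← hC]
    ext i j
    by_cases h : i = j <;> simp [B, h, natCast_apply]
  have hdet : B.det ≠ 0 := by
    intro h
    have := (Int.castRingHom ℚ).map_det B
    rw [hB, h, det_smul, map_zero] at this
    exact mul_ne_zero (pow_ne_zero _ (Nat.cast_ne_zero.2 hk.ne')) hΦ this.symm
  refine ⟨B.det.natAbs, Int.natAbs_pos.2 hdet, fun v ↦ ?_⟩
  let u : ι → ℤ := B.det.sign • (B.adjugate *ᵥ v)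
  refine ⟨u, C *ᵥ u, ?_, ?_⟩
  · have h1 : (fun t ↦ (((k : ℤ) * u t : ℤ) : ℚ)) = (k : ℚ) • fun t ↦ (u t : ℚ) := by
      ext t
      simp
    rw [h1, mulVec_smul, ← smul_mulVec, ← hC]
    ext t
    simp [mulVec, dotProduct]
  · have h2 : C *ᵥ u - (k : ℤ) • u = B *ᵥ u := by
      simp [B, sub_mulVec]
    rw [h2]
    simp only [u, mulVec_smul, mulVec_mulVec, mul_adjugate, smul_mulVec, one_mulVec]
    rw [smul_smul, Int.sign_mul_self_eq_natAbs, natCast_zsmul]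

end Matrix

/-- Let `Φ` be an `m×m` rational matrix not having `1` as an eigenvalue, let
`T : ℤ^m → GL_n(ℚ)` be a group homomorphism with every `T v` semisimple and net, and `M` an
`n×n` complex matrix.  If there is a positive integer `k` with `Φ·(k v) ∈ ℤ^m` for all `v`
and `M·T(k v) = T(Φ·(k v))·M` for all `v`, then `det(I − T(v)·M) = det(I − M)` for all `v`. -/
theorem det_one_sub_semisimple_mul {n m : ℕ}
    (Φ : Matrix (Fin m) (Fin m) ℚ) (hΦ1 : (Φ - 1).det ≠ 0)
    (T : (Fin m → ℤ) → Matrix (Fin n) (Fin n) ℚ)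
    (hT1 : T 0 = 1) (hTmul : ∀ v w, T (v + w) = T v * T w) (hTunit : ∀ v, IsUnit (T v))
    (hTss : ∀ v, IsSemisimpleMat (T v))
    (hTnet : ∀ v, ((T v).map (Rat.cast : ℚ → ℂ)).IsNet)
    (M : Matrix (Fin n) (Fin n) ℂ)
    (k : ℕ) (hk : 0 < k)
    (hΦint : ∀ v : Fin m → ℤ, ∃ w : Fin m → ℤ,
      Φ.mulVec (fun t => (((k : ℤ) * v t : ℤ) : ℚ)) = fun t => ((w t : ℤ) : ℚ))
    (hcomm : ∀ v w : Fin m → ℤ,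
      (Φ.mulVec (fun t => (((k : ℤ) * v t : ℤ) : ℚ)) = fun t => ((w t : ℤ) : ℚ)) →
      M * (T ((k : ℤ) • v)).map (Rat.cast : ℚ → ℂ) =
        (T w).map (Rat.cast : ℚ → ℂ) * M) :
    ∀ v : Fin m → ℤ,
      (1 - (T v).map (Rat.cast : ℚ → ℂ) * M).det = (1 - M).det := by
  let A (v : Fin m → ℤ) : Matrix (Fin n) (Fin n) ℂ := (T v).map (Rat.cast : ℚ → ℂ)
  have hA0 : A 0 = 1 := by
    simp only [A, hT1]
    exact map_one (Rat.castHom ℂ).mapMatrix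
  have hAadd (v w : Fin m → ℤ) : A (v + w) = A v * A w := by
    simp only [A, hTmul]
    exact map_mul (Rat.castHom ℂ).mapMatrix _ _
  obtain ⟨P, hP, d, hd⟩ := Matrix.exists_simultaneous_diagonalization A
    (fun v w ↦ by rw [commute_iff_eq, ← hAadd, ← hAadd, add_comm]) hTss
  have hPP : P⁻¹ * P = 1 := Matrix.nonsing_inv_mul _ ((Matrix.isUnit_iff_isUnit_det P).1 hP)
  have hPP' : P * P⁻¹ = 1 := Matrix.mul_nonsing_inv _ ((Matrix.isUnit_iff_isUnit_det P).1 hP)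
  have hdA (v : Fin m → ℤ) : Matrix.diagonal (d v) = P⁻¹ * A v * P := by
    rw [hd]
    simp only [mul_assoc, hPP, mul_one]
    rw [← mul_assoc, hPP, one_mul]
  have hd0 : d 0 = 1 := Matrix.diagonal_injective <| by
    rw [hdA, hA0, mul_one, hPP, Pi.one_def, Matrix.diagonal_one]
  have hdadd (v w : Fin m → ℤ) : d (v + w) = d v * d w := Matrix.diagonal_injective <| by
    rw [Pi.mul_def, ← Matrix.diagonal_mul_diagonal, hdA, hdA, hdA, hAadd]
    simp only [mul_assoc]
    rw [← mul_assoc P, hPP', one_mul]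
  let χ (i : Fin n) : AddChar (Fin m → ℤ) ℂ :=
    { toFun := fun v ↦ d v i
      map_zero_eq_one' := by simp [hd0]
      map_add_eq_mul' := by simp [hdadd] }
  have hspec (v : Fin m → ℤ) (i : Fin n) : χ i v ∈ spectrum ℂ (A v) := by
    rw [hd v]
    exact Matrix.mem_spectrum_conj_diagonal hP (d v) i
  let N := P⁻¹ * M * P
  have hM : M = P * N * P⁻¹ := by
    simp only [N, mul_assoc, hPP', mul_one]
    rw [← mul_assoc, hPP', one_mul]
  have hN (u w : Fin m → ℤ)
      (h : Φ.mulVec (fun t ↦ (((k : ℤ) * u t : ℤ) : ℚ)) = fun t ↦ ((w t : ℤ) : ℚ))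
      (i j : Fin n) (hij : N j i ≠ 0) : χ i ((k : ℤ) • u) = χ j w := by
    have hMA : M * A ((k : ℤ) • u) = A w * M := hcomm u w h
    have hND : N * Matrix.diagonal (d ((k : ℤ) • u)) = Matrix.diagonal (d w) * N := by
      have e1 : N * Matrix.diagonal (d ((k : ℤ) • u)) = P⁻¹ * (M * A ((k : ℤ) • u)) * P := by
        rw [hdA]
        simp only [N, mul_assoc]
        rw [← mul_assoc P P⁻¹, hPP', one_mul]
      have e2 : Matrix.diagonal (d w) * N = P⁻¹ * (A w * M) * P := by
        rw [hdA]
        simp only [N, mul_assoc]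
        rw [← mul_assoc P P⁻¹, hPP', one_mul]
      rw [e1, e2, hMA]
    have := congrFun (congrFun hND j) i
    rw [Matrix.mul_diagonal, Matrix.diagonal_mul, mul_comm] at this
    exact mul_right_cancel₀ hij this
  intro v
  have h1 : 1 - A v * M = P * (1 - Matrix.diagonal (d v) * N) * P⁻¹ := by
    rw [hdA, mul_sub, sub_mul, mul_one, hPP']
    congr 1
    simp only [N, mul_assoc, hPP', mul_one]
    rw [← mul_assoc P P⁻¹, hPP', one_mul, ← mul_assoc P P⁻¹, hPP', one_mul]
  have h2 : 1 - M = P * (1 - N) * P⁻¹ := by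
    rw [mul_sub, sub_mul, mul_one, hPP', ← hM]
  change (1 - A v * M).det = (1 - M).det
  rw [h1, h2, Matrix.det_conj hP, Matrix.det_conj hP]
  refine Matrix.det_one_sub_diagonal_mul_of_prod_eq_one _ _ fun σ s hσ hs ↦ ?_
  obtain ⟨r, hr, hroot⟩ := Matrix.exists_pos_nsmul_eq_sub Φ hΦ1 hk hΦint
  obtain ⟨u, w, hw, hvuw⟩ := hroot v
  let θ : AddChar (Fin m → ℤ) ℂ := ∏ i ∈ s, χ i
  have hθ : θ ((k : ℤ) • u) = θ w := by
    simp only [θ, AddChar.prod_apply]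
    rw [← Equiv.Perm.prod_comp σ s (fun i ↦ χ i w) hσ]
    exact Finset.prod_congr rfl fun i hi ↦ hN u w hw i (σ i) (hs i hi)
  have hθr : θ v ^ r = 1 := by
    rw [← AddChar.map_nsmul_eq_pow, hvuw, sub_eq_add_neg, AddChar.map_add_eq_mul, ← hθ,
      ← AddChar.map_add_eq_mul, add_neg_cancel, AddChar.map_zero_eq_one]
  let χu (i : Fin n) : ℂˣ := ((χ i).val_isUnit v).unit
  have hprod : ((∏ i ∈ s, χu i : ℂˣ) : ℂ) = θ v := by
    simp [χu, θ, AddChar.prod_apply]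
  have hone := hTnet v (∏ i ∈ s, χu i)
    (Subgroup.prod_mem _ fun i _ ↦ Subgroup.subset_closure (hspec v i)) r hr
    (Units.ext (by rw [Units.val_pow_eq_pow_val, hprod, hθr, Units.val_one]))
  rw [hone, Units.val_one] at hprod
  rw [AddChar.prod_apply] at hprod
  exact hprod.symm
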